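/- arXiv:1105.1305 — 2 statements merged into one kernel-verified Lean document; each statement's English description precedes it below -/
import Mathlib

section
/- The natural density of squarefree integers in a residue class a modulo 36 with gcd(a, 36) squarefree equals 9/π², i.e. the limit as x → ∞ of (1/x)·#{n ≤ x : n ≡ a (mod 36), n squarefree} equals (1/36)·(4/3)·(9/8)·(6/π²) = 1/(4·ζ(2)). -/
open Filter Real

open ArithmeticFunction ArithmeticFunction.Moebius in
theorem sum_moebius_eq_ite {b : ℕ} : ∑ d ∈ b.divisors, μ d = if b = 1 then 1 else 0 := by
  rw [← coe_mul_zeta_apply, moebius_mul_coe_zeta, one_apply]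

theorem sq_dvd_sq_mul_iff_of_squarefree {d b s : ℕ} (hs : Squarefree s) (hb : b ≠ 0) :
    d ^ 2 ∣ b ^ 2 * s ↔ d ∣ b := by
  refine ⟨fun h => ?_, fun h => (pow_dvd_pow_of_dvd h 2).mul_right s⟩
  have hs0 : s ≠ 0 := hs.ne_zero
  have hd : d ≠ 0 := by
    rintro rfl
    simp [hb, hs0] at h
  rw [← Nat.factorization_le_iff_dvd (by positivity) (by positivity),
    Nat.factorization_mul (by positivity) hs0, Nat.factorization_pow, Nat.factorization_pow] at h
  rw [← Nat.factorization_le_iff_dvd hd hb]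
  intro p
  have h1 := h p
  have h2 := hs.natFactorization_le_one p
  simp only [Finsupp.smul_apply, Finsupp.add_apply, smul_eq_mul] at h1
  lia

open ArithmeticFunction ArithmeticFunction.Moebius in
/-- The indicator of the squarefree numbers as a sum of Möbius values over square divisors. -/
theorem sum_moebius_sq_dvd {n x : ℕ} (hn : n ≠ 0) (hx : n < x) :
    ∑ d ∈ Finset.range x, (if d ^ 2 ∣ n then μ d else 0) = if Squarefree n then 1 else 0 := by
  obtain ⟨s, b, hsb, hs⟩ := Nat.sq_mul_squarefree n
  have hb : b ≠ 0 := by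
    rintro rfl
    simp at hsb
    exact hn hsb.symm
  have hbn : b ≤ n := by
    have := Nat.pos_of_ne_zero hs.ne_zero
    have := Nat.pos_of_ne_zero hb
    nlinarith
  subst hsb
  simp_rw [sq_dvd_sq_mul_iff_of_squarefree hs hb]
  rw [← Finset.sum_filter]
  have : (Finset.range x).filter (· ∣ b) = b.divisors := by
    ext d
    simp only [Finset.mem_filter, Finset.mem_range, Nat.mem_divisors]
    exact ⟨fun h => ⟨h.2, hb⟩,
      fun h => ⟨((Nat.le_of_dvd (Nat.pos_of_ne_zero hb) h.1).trans hbn).trans_lt hx, h.1⟩⟩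
  rw [this, sum_moebius_eq_ite]
  congr 1
  refine propext ⟨fun h => by simpa [h] using hs, fun h => ?_⟩
  exact Nat.isUnit_iff.mp (h b ⟨s, by ring⟩)

theorem tendsto_count_modEq_div {r : ℕ} (hr : 0 < r) (v : ℕ) :
    Tendsto (fun x : ℕ => (x.count (· ≡ v [MOD r]) : ℝ) / x) atTop (nhds (1 / r)) := by
  have hr' : (0 : ℝ) < r := by exact_mod_cast hr
  have key : ∀ x : ℕ, |(x.count (· ≡ v [MOD r]) : ℝ) - x / r| ≤ 1 := by
    intro x
    have h1 : (x : ℝ) / r - 1 ≤ (x / r : ℕ) := by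
      have := Nat.lt_floor_add_one ((x : ℝ) / r)
      rw [Nat.floor_div_eq_div] at this
      linarith
    have h2 : ((x / r : ℕ) : ℝ) ≤ x / r := Nat.cast_div_le
    rw [Nat.count_modEq_card x hr v, abs_le]
    split_ifs with h
    · push_cast
      constructor <;> linarith
    · push_cast
      constructor <;> linarith
  rw [tendsto_iff_norm_sub_tendsto_zero]
  refine squeeze_zero' (Eventually.of_forall fun _ => norm_nonneg _) ?_
    tendsto_one_div_atTop_nhds_zero_nat
  filter_upwards [eventually_gt_atTop 0] with x hx
  have hx' : (0 : ℝ) < x := by exact_mod_cast hx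
  have : (x.count (· ≡ v [MOD r]) : ℝ) / x - 1 / r = (x.count (· ≡ v [MOD r]) - x / r) / x := by
    field_simp
  rw [this, Real.norm_eq_abs, abs_div, abs_of_pos hx']
  exact div_le_div_of_nonneg_right (key x) hx'.le

theorem tendsto_card_filter_mod_sq_dvd_div {m a d : ℕ} (ham : a < m) (hd : d ≠ 0)
    (hdm : d.Coprime m) :
    Tendsto (fun x : ℕ =>
      (((Finset.range x).filter (fun n => n % m = a ∧ d ^ 2 ∣ n)).card : ℝ) / x)
      atTop (nhds (1 / (m * d ^ 2))) := by
  have hco : m.Coprime (d ^ 2) := (hdm.pow_left 2).symm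
  obtain ⟨v, hv1, hv2⟩ := Nat.chineseRemainder hco a 0
  have hr : 0 < m * d ^ 2 := by
    have : 0 < m := by lia
    positivity
  convert tendsto_count_modEq_div hr v using 4 with x
  · rw [Nat.count_eq_card_filter_range]
    congr 2
    ext n
    rw [← Nat.modEq_and_modEq_iff_modEq_mul hco, ← Nat.modEq_zero_iff_dvd]
    refine and_congr ?_ ⟨fun h => h.trans hv2.symm, fun h => h.trans hv2⟩
    have h : n % m = a ↔ n ≡ a [MOD m] := by rw [Nat.ModEq, Nat.mod_eq_of_lt ham]
    rw [h]
    exact ⟨fun h => h.trans hv1.symm, fun h => h.trans hv1⟩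
  · push_cast
    rfl

theorem card_filter_mod_sq_dvd_le {m a : ℕ} (ha : a ≠ 0) (d x : ℕ) :
    (((Finset.range x).filter (fun n => n % m = a ∧ d ^ 2 ∣ n)).card : ℝ) ≤ x / d ^ 2 := by
  have h : ((Finset.range x).filter (fun n => n % m = a ∧ d ^ 2 ∣ n)).card ≤ x / d ^ 2 := by
    rw [← Nat.card_multiples']
    refine Finset.card_le_card fun n => ?_
    simp only [Finset.mem_filter, Finset.mem_range]
    rintro ⟨h1, h2, h3⟩
    refine ⟨by lia, ?_, h3⟩
    rintro rfl
    simp at h2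
    exact ha h2.symm
  calc _ ≤ ((x / d ^ 2 : ℕ) : ℝ) := by exact_mod_cast h
    _ ≤ _ := by exact_mod_cast (Nat.cast_div_le (α := ℝ) (m := x) (n := d ^ 2))

open ArithmeticFunction ArithmeticFunction.Moebius in
theorem card_filter_mod_squarefree {m a : ℕ} (ha : a ≠ 0) (x : ℕ) :
    (((Finset.range x).filter (fun n => n % m = a ∧ Squarefree n)).card : ℝ) =
      ∑' d : ℕ, (μ d : ℝ) *
        ((Finset.range x).filter (fun n => n % m = a ∧ d ^ 2 ∣ n)).card := by
  rw [tsum_eq_sum (s := Finset.range x)]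
  · have : (((Finset.range x).filter (fun n => n % m = a ∧ Squarefree n)).card : ℤ) =
        ∑ d ∈ Finset.range x, μ d *
          ((Finset.range x).filter (fun n => n % m = a ∧ d ^ 2 ∣ n)).card := by
      simp_rw [← Finset.filter_filter, Finset.card_filter (fun n => _ ∣ n),
        Finset.card_filter Squarefree]
      push_cast
      simp_rw [Finset.mul_sum]
      rw [Finset.sum_comm]
      refine Finset.sum_congr rfl fun n hn => ?_
      simp only [Finset.mem_filter, Finset.mem_range] at hn
      have hn0 : n ≠ 0 := by
        rintro rfl
        simp at hn
        exact ha hn.2.symm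
      rw [← sum_moebius_sq_dvd hn0 hn.1]
      simp
    exact_mod_cast this
  · intro d hd
    simp only [Finset.mem_range, not_lt] at hd
    refine mul_eq_zero_of_right _ ?_
    rw [Nat.cast_eq_zero, Finset.card_eq_zero, Finset.filter_eq_empty_iff]
    rintro n hn ⟨h1, h2⟩
    have hn0 : n ≠ 0 := by
      rintro rfl
      simp at h1
      exact ha h1.symm
    have := Nat.le_of_dvd (Nat.pos_of_ne_zero hn0) h2
    have := Finset.mem_range.mp hn
    nlinarith

open ArithmeticFunction ArithmeticFunction.Moebius in
/-- If every prime factor of `m` divides `m` twice and `gcd(a, m)` is squarefree, then the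
squarefree numbers in the residue class of `a` modulo `m` have a natural density. -/
theorem tendsto_card_filter_mod_squarefree_div {m a : ℕ} (ham : a < m) (ha : a ≠ 0)
    (hm : ∀ p : ℕ, p.Prime → p ∣ m → p ^ 2 ∣ m) (hsq : Squarefree (a.gcd m)) :
    Tendsto (fun x : ℕ =>
      (((Finset.range x).filter (fun n => n % m = a ∧ Squarefree n)).card : ℝ) / x)
      atTop (nhds (∑' d : ℕ, (μ d : ℝ) * if d.Coprime m then 1 / (m * d ^ 2 : ℝ) else 0)) := by
  simp_rw [card_filter_mod_squarefree ha, ← tsum_div_const, mul_div_assoc]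
  refine tendsto_tsum_of_dominated_convergence (bound := fun d : ℕ => 1 / (d : ℝ) ^ 2)
    (Real.summable_one_div_nat_pow.mpr one_lt_two) (fun d => ?_) ?_
  · refine Tendsto.const_mul _ ?_
    split_ifs with hd
    · rcases eq_or_ne d 0 with rfl | hd0
      · obtain rfl : m = 1 := by simpa using hd
        lia
      · exact tendsto_card_filter_mod_sq_dvd_div ham hd0 hd
    · obtain ⟨p, hp, hpd, hpm⟩ := Nat.Prime.not_coprime_iff_dvd.mp hd
      refine tendsto_const_nhds.congr fun x => ?_
      rw [eq_comm, div_eq_zero_iff, Nat.cast_eq_zero, Finset.card_eq_zero,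
        Finset.filter_eq_empty_iff]
      left
      rintro n - ⟨rfl, h2⟩
      have h3 : p ^ 2 ∣ n := (pow_dvd_pow_of_dvd hpd 2).trans h2
      have h4 := (Nat.dvd_mod_iff (hm p hp hpm)).mpr h3
      have h5 := hsq p (by rw [← sq]; exact Nat.dvd_gcd h4 (hm p hp hpm))
      exact hp.not_isUnit h5
  · filter_upwards [eventually_gt_atTop 0] with x hx d
    have hx' : (0 : ℝ) < x := by exact_mod_cast hx
    have h1 : |(μ d : ℝ)| ≤ 1 := by exact_mod_cast abs_moebius_le_one
    have h2 := card_filter_mod_sq_dvd_le (m := m) ha d x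
    rw [norm_mul, Real.norm_eq_abs, Real.norm_eq_abs, abs_of_nonneg (a := _ / _) (by positivity)]
    refine (mul_le_of_le_one_left (by positivity) h1).trans ?_
    rw [div_le_iff₀ hx']
    exact h2.trans_eq (by ring)

open ArithmeticFunction ArithmeticFunction.Moebius in
theorem tsum_moebius_coprime_div_sq (m : ℕ) [NeZero m] :
    ∑' d : ℕ, (μ d : ℝ) * (if d.Coprime m then 1 / (d ^ 2 : ℝ) else 0) =
      ((∏ p ∈ m.primeFactors, (1 - ((p : ℝ) ^ 2)⁻¹)) * (π ^ 2 / 6))⁻¹ := by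
  have hs : 1 < (2 : ℂ).re := by norm_num
  have h := DirichletCharacter.LSeries.mul_mu_eq_one (1 : DirichletCharacter ℂ m) hs
  rw [← DirichletCharacter.LFunction_eq_LSeries _ hs] at h
  have h2 := DirichletCharacter.LFunctionTrivChar_eq_mul_riemannZeta (N := m)
    (s := 2) (by norm_num)
  rw [DirichletCharacter.LFunctionTrivChar] at h2
  rw [h2, riemannZeta_two] at h
  apply eq_inv_of_mul_eq_one_right
  rw [← Complex.ofReal_inj]
  push_cast
  convert h using 2
  · simp [Complex.cpow_neg]
  · rw [LSeries]
    refine tsum_congr fun d => ?_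
    rw [LSeries.term_def]
    rcases eq_or_ne d 0 with rfl | hd
    · simp
    · by_cases hc : d.Coprime m
      · have hu : IsUnit (d : ZMod m) := (ZMod.isUnit_iff_coprime d m).mpr hc
        rw [if_pos hc]
        simp [hd, MulChar.one_apply hu, div_eq_mul_inv]
      · have hu : ¬ IsUnit (d : ZMod m) := fun h => hc ((ZMod.isUnit_iff_coprime d m).mp h)
        rw [if_neg hc]
        simp [MulChar.map_nonunit _ hu]

/-- The natural density of squarefree integers in a residue class a mod 36 with
gcd(a,36) squarefree equals (1/36)·(4/3)·(9/8)·(6/π²). -/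
theorem stmt_2 :
    ∀ a < 36, Squarefree (Nat.gcd a 36) →
      Tendsto
        (fun x : ℕ =>
          (((Finset.range x).filter (fun n => n % 36 = a ∧ Squarefree n)).card : ℝ) / x)
        atTop
        (nhds ((1 / 36) * (4 / 3) * (9 / 8) * (6 / π ^ 2))) := by
  intro a ha hsq
  have hpf : Nat.primeFactors 36 = {2, 3} := by
    rw [show 36 = (2 * 3) ^ 2 by norm_num, Nat.primeFactors_pow _ two_ne_zero,
      Nat.primeFactors_mul two_ne_zero three_ne_zero, Nat.prime_two.primeFactors,
      Nat.prime_three.primeFactors]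
    rfl
  have ha0 : a ≠ 0 := by
    rintro rfl
    have := hsq 6 (by norm_num)
    simp at this
  have hm : ∀ p : ℕ, p.Prime → p ∣ 36 → p ^ 2 ∣ 36 := by
    intro p hp hd
    have : p ∈ Nat.primeFactors 36 := Nat.mem_primeFactors.mpr ⟨hp, hd, by norm_num⟩
    rw [hpf] at this
    simp only [Finset.mem_insert, Finset.mem_singleton] at this
    rcases this with rfl | rfl <;> norm_num
  convert tendsto_card_filter_mod_squarefree_div ha ha0 hm hsq using 2
  have h := congrArg (fun t : ℝ => 1 / 36 * t) (tsum_moebius_coprime_div_sq 36)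
  simp only [hpf, ← tsum_mul_left] at h
  have hpi := Real.pi_ne_zero
  calc _ = _ := ?_
    _ = _ := h.symm
    _ = _ := tsum_congr fun d => ?_
  · rw [Finset.prod_pair (by norm_num)]
    field_simp
    norm_num
  · split_ifs
    · push_cast
      ring
    · simp
end

section
/- For every ε > 0 there exists a set A ⊆ ℕ of lower natural density greater than 1/4 − 2/π² − ε such that A + A contains no squarefree integer, A + A + A contains all but finitely many positive integers, and the set of non-squarefree integers not in A + A has upper density at most ε. -/
open Filter Real

lemma card_filter_range_mod_four_eq_two (x : ℕ) :
    ((Finset.range x).filter (fun n => n % 4 = 2)).card = (x + 1) / 4 := by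
  induction x with
  | zero => simp
  | succ x ih =>
    rw [Finset.range_add_one, Finset.filter_insert]
    split_ifs with h
    · rw [Finset.card_insert_of_notMem (by simp), ih]
      omega
    · rw [ih]
      omega

/-- The integers congruent to `2` modulo `4` and free of square factors `p ^ 2`, `p ∈ T`, have
density `∏ p ∈ T, (1 - 1 / p ^ 2) / 4`, with a bounded counting error. -/
lemma exists_abs_card_filter_sq_dvd_sub_le (T : Finset ℕ) (hT : ∀ p ∈ T, p.Prime ∧ p ≠ 2) :
    ∃ K : ℝ, ∀ x : ℕ,
      |(((Finset.range x).filter (fun n => n % 4 = 2 ∧ ∀ p ∈ T, ¬ p ^ 2 ∣ n)).card : ℝ) -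
        x * ((1 / 4) * ∏ p ∈ T, (1 - 1 / (p : ℝ) ^ 2))| ≤ K := by
  induction T using Finset.induction_on with
  | empty =>
    refine ⟨1, fun x => ?_⟩
    simp only [Finset.notMem_empty, false_imp_iff, implies_true, and_true,
      card_filter_range_mod_four_eq_two, Finset.prod_empty, mul_one]
    have h1 : (((x + 1) / 4 : ℕ) : ℝ) * 4 ≤ x + 1 := by
      exact_mod_cast Nat.div_mul_le_self (x + 1) 4
    have h2 : (x : ℝ) ≤ (((x + 1) / 4 : ℕ) : ℝ) * 4 + 2 := by
      exact_mod_cast (by omega : x ≤ (x + 1) / 4 * 4 + 2)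
    rw [abs_le]
    constructor <;> linarith
  | insert q T hq ih =>
    obtain ⟨K, hK⟩ := ih fun p hp => hT p (Finset.mem_insert_of_mem hp)
    obtain ⟨hqp, hq2⟩ := hT q (Finset.mem_insert_self q T)
    have hq0 : 0 < q ^ 2 := pow_pos hqp.pos 2
    have hq4 : q ^ 2 % 4 = 1 := by
      have : q % 2 = 1 := hqp.eq_two_or_odd.resolve_left hq2
      have : q % 4 = 1 ∨ q % 4 = 3 := by omega
      rcases this with h | h <;> simp [Nat.pow_mod, h]
    set D : ℝ := (1 / 4) * ∏ p ∈ T, (1 - 1 / (p : ℝ) ^ 2) with hD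
    refine ⟨K + K + |D|, fun x => ?_⟩
    set y := (x + (q ^ 2 - 1)) / q ^ 2 with hy
    have hmem : ∀ m, m < y ↔ q ^ 2 * m < x := fun m => by
      rw [hy, ← Nat.succ_le_iff, Nat.le_div_iff_mul_le hq0, Nat.succ_mul, mul_comm m]
      omega
    have hsplit : ((Finset.range x).filter (fun n => n % 4 = 2 ∧ ∀ p ∈ T, ¬ p ^ 2 ∣ n)).card =
        ((Finset.range x).filter
          (fun n => n % 4 = 2 ∧ ∀ p ∈ insert q T, ¬ p ^ 2 ∣ n)).card +
        ((Finset.range y).filter (fun n => n % 4 = 2 ∧ ∀ p ∈ T, ¬ p ^ 2 ∣ n)).card := by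
      rw [← Finset.card_filter_add_card_filter_not (fun n => ¬ q ^ 2 ∣ n), Finset.filter_filter,
        Finset.filter_filter]
      congr 1
      · congr 1
        ext n
        simp only [Finset.mem_filter, Finset.mem_insert, forall_eq_or_imp]
        tauto
      · symm
        refine Finset.card_bij (fun m _ => q ^ 2 * m) ?_ ?_ ?_
        · intro m hm
          simp only [Finset.mem_filter, Finset.mem_range, hmem] at hm ⊢
          refine ⟨hm.1, ⟨by rw [Nat.mul_mod, hq4, one_mul, Nat.mod_mod]; exact hm.2.1, ?_⟩, by simp⟩
          intro p hp hd
          refine hm.2.2 p hp (Nat.Coprime.dvd_of_dvd_mul_left ?_ hd)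
          have hpq : p ≠ q := fun h => hq (h ▸ hp)
          exact ((Nat.coprime_primes (hT p (Finset.mem_insert_of_mem hp)).1 hqp).2 hpq).pow 2 2
        · intro a _ b _ h
          exact Nat.eq_of_mul_eq_mul_left hq0 h
        · intro n hn
          simp only [Finset.mem_filter, Finset.mem_range, not_not] at hn
          obtain ⟨hnx, ⟨hn4, hnT⟩, m, rfl⟩ := hn
          refine ⟨m, ?_, rfl⟩
          simp only [Finset.mem_filter, Finset.mem_range, hmem]
          refine ⟨hnx, ?_, fun p hp hd => hnT p hp (hd.mul_left _)⟩
          rwa [Nat.mul_mod, hq4, one_mul, Nat.mod_mod] at hn4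
    have hyx : |(y : ℝ) - x / (q : ℝ) ^ 2| ≤ 1 := by
      have hq0' : (0 : ℝ) < (q : ℝ) ^ 2 := by exact_mod_cast hq0
      have h1 : y * q ^ 2 ≤ x + q ^ 2 := (Nat.div_mul_le_self _ _).trans (by omega)
      have h2 : x ≤ y * q ^ 2 := by
        by_contra! h
        exact lt_irrefl y ((hmem y).2 (by rwa [mul_comm]))
      have h1' : (y : ℝ) * (q : ℝ) ^ 2 ≤ x + (q : ℝ) ^ 2 := by exact_mod_cast h1
      have h2' : (x : ℝ) ≤ y * (q : ℝ) ^ 2 := by exact_mod_cast h2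
      have h3 : (x : ℝ) / (q : ℝ) ^ 2 ≤ y := by rwa [div_le_iff₀ hq0']
      have h4 : (y : ℝ) - 1 ≤ x / (q : ℝ) ^ 2 := by
        rw [le_div_iff₀ hq0']
        linarith
      rw [abs_le]
      constructor <;> linarith
    have hsplit' := congrArg (Nat.cast (R := ℝ)) hsplit
    rw [Nat.cast_add] at hsplit'
    rw [Finset.prod_insert hq]
    have hprod : (1 / 4 : ℝ) * ((1 - 1 / (q : ℝ) ^ 2) * ∏ p ∈ T, (1 - 1 / (p : ℝ) ^ 2)) =
        (1 - 1 / (q : ℝ) ^ 2) * D := by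
      rw [hD]
      ring
    rw [hprod, ← sub_eq_of_eq_add hsplit']
    have hx := hK x
    have hy' := hK y
    have hyD : |((y : ℝ) - x / (q : ℝ) ^ 2) * D| ≤ |D| := by
      rw [abs_mul]
      exact mul_le_of_le_one_left (abs_nonneg D) hyx
    refine le_trans (le_of_eq ?_) ((abs_sub _ _).trans (add_le_add ((abs_sub _ _).trans
      (add_le_add hx hy')) hyD))
    congr 1
    ring

/-- The partial Euler products of `1 / ζ(2)` converge to `6 / π ^ 2`. -/
lemma tendsto_prod_primesBelow_one_sub_inv_sq :
    Tendsto (fun N : ℕ => ∏ p ∈ N.primesBelow, (1 - 1 / (p : ℝ) ^ 2)) atTop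
      (nhds (6 / π ^ 2)) := by
  have h := riemannZeta_eulerProduct (s := 2) (by norm_num)
  rw [riemannZeta_two] at h
  have h2 := (Complex.continuous_re.tendsto _).comp h
  have h3 : ((π : ℂ) ^ 2 / 6).re = π ^ 2 / 6 := by
    rw [show ((π : ℂ) ^ 2 / 6) = ((π ^ 2 / 6 : ℝ) : ℂ) by push_cast; rfl, Complex.ofReal_re]
  rw [h3] at h2
  have h4 := h2.inv₀ (by positivity)
  rw [inv_div] at h4
  refine h4.congr fun N => ?_
  have : ∏ p ∈ N.primesBelow, (1 - (p : ℂ) ^ (-2 : ℂ))⁻¹ =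
      ((∏ p ∈ N.primesBelow, (1 - 1 / (p : ℝ) ^ 2)⁻¹ : ℝ) : ℂ) := by
    push_cast
    refine Finset.prod_congr rfl fun p _ => ?_
    rw [Complex.cpow_neg, one_div]
    norm_cast
  rw [Function.comp_apply, this, Complex.ofReal_re, Finset.prod_inv_distrib, inv_inv]

open scoped Classical in
/-- The positive integers below `x` having a square divisor `d ^ 2` with `d > k` number at most
`2 * x / (k + 1)`. -/
lemma card_filter_exists_sq_dvd_le (k x : ℕ) :
    (((Finset.range x).filter (fun n => 0 < n ∧ ∃ d, k < d ∧ d ^ 2 ∣ n)).card : ℝ) ≤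
      x * (2 / (k + 1)) := by
  have hsub : (Finset.range x).filter (fun n => 0 < n ∧ ∃ d, k < d ∧ d ^ 2 ∣ n) ⊆
      (Finset.Ioo k x).biUnion fun d => (Finset.Ioc 0 x).filter (d ^ 2 ∣ ·) := by
    intro n hn
    simp only [Finset.mem_filter, Finset.mem_range] at hn
    obtain ⟨hnx, hn0, d, hd, hdn⟩ := hn
    simp only [Finset.mem_biUnion, Finset.mem_filter, Finset.mem_Ioo, Finset.mem_Ioc]
    exact ⟨d, ⟨hd, ((Nat.le_self_pow two_ne_zero d).trans (Nat.le_of_dvd hn0 hdn)).trans_lt hnx⟩,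
      ⟨hn0, hnx.le⟩, hdn⟩
  have h1 := (Finset.card_le_card hsub).trans Finset.card_biUnion_le
  calc _ ≤ ((∑ d ∈ Finset.Ioo k x, ((Finset.Ioc 0 x).filter (d ^ 2 ∣ ·)).card : ℕ) : ℝ) := by
        exact_mod_cast h1
    _ = ∑ d ∈ Finset.Ioo k x, ((x / d ^ 2 : ℕ) : ℝ) := by
        push_cast [Nat.Ioc_filter_dvd_card_eq_div]
        rfl
    _ ≤ ∑ d ∈ Finset.Ioo k x, (x : ℝ) * ((d : ℝ) ^ 2)⁻¹ := by
        refine Finset.sum_le_sum fun d _ => Nat.cast_div_le.trans_eq ?_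
        push_cast
        rw [div_eq_mul_inv]
    _ ≤ _ := by
        rw [← Finset.mul_sum]
        exact mul_le_mul_of_nonneg_left (sum_Ioo_inv_sq_le k x) (Nat.cast_nonneg x)

/-- The odd primes below `N`. -/
def oddPrimesBelow (N : ℕ) : Finset ℕ := N.primesBelow.erase 2

lemma mem_oddPrimesBelow {N p : ℕ} : p ∈ oddPrimesBelow N ↔ p ≠ 2 ∧ p < N ∧ p.Prime := by
  simp [oddPrimesBelow, Nat.mem_primesBelow]

/-- The product of the squares of the odd primes below `N`. -/
def oddPrimorialSq (N : ℕ) : ℕ := ∏ p ∈ oddPrimesBelow N, p ^ 2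

lemma sq_dvd_oddPrimorialSq {N p : ℕ} (hp : p ∈ oddPrimesBelow N) : p ^ 2 ∣ oddPrimorialSq N :=
  Finset.dvd_prod_of_mem (fun p => p ^ 2) hp

lemma oddPrimorialSq_mod_four (N : ℕ) : oddPrimorialSq N % 4 = 1 := by
  refine Finset.prod_induction (fun p => p ^ 2) (fun m => m % 4 = 1) ?_ rfl ?_
  · intro a b ha hb
    simp [Nat.mul_mod, ha, hb]
  · intro p hp
    obtain ⟨h2, -, hp⟩ := mem_oddPrimesBelow.1 hp
    have : p % 2 = 1 := hp.eq_two_or_odd.resolve_left h2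
    have : p % 4 = 1 ∨ p % 4 = 3 := by omega
    rcases this with h | h <;> simp [Nat.pow_mod, h]

/-- The integers congruent to `2` modulo `4` divisible by the square of an odd prime below `N`. -/
def twiceOddWithSmallSq (N : ℕ) : Set ℕ := {n | n % 4 = 2 ∧ ∃ p ∈ oddPrimesBelow N, p ^ 2 ∣ n}

/-- The set `twiceOddWithSmallSq N` enlarged by three multiples of `oddPrimorialSq N`, one in each
of the residue classes `0`, `1`, `3` modulo `4`. -/
def sumsetAvoidingSquarefree (N : ℕ) : Set ℕ :=
  twiceOddWithSmallSq N ∪ {oddPrimorialSq N, 3 * oddPrimorialSq N, 4 * oddPrimorialSq N}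

lemma mem_sumsetAvoidingSquarefree_cases {N a : ℕ} (ha : a ∈ sumsetAvoidingSquarefree N) :
    a ∈ twiceOddWithSmallSq N ∨ oddPrimorialSq N ∣ a := by
  rcases ha with h | rfl | rfl | rfl
  · exact Or.inl h
  · exact Or.inr dvd_rfl
  · exact Or.inr (dvd_mul_left _ _)
  · exact Or.inr (dvd_mul_left _ _)

lemma not_squarefree_of_sq_dvd {p n : ℕ} (hp : p.Prime) (h : p ^ 2 ∣ n) : ¬ Squarefree n :=
  fun hn => Nat.squarefree_iff_prime_squarefree.1 hn p hp (by rwa [← sq])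

lemma not_squarefree_add {N a b : ℕ} (hN : 6 ≤ N) (ha : a ∈ sumsetAvoidingSquarefree N)
    (hb : b ∈ sumsetAvoidingSquarefree N) : ¬ Squarefree (a + b) := by
  have key : ∀ p ∈ oddPrimesBelow N, p ^ 2 ∣ a → p ^ 2 ∣ b → ¬ Squarefree (a + b) :=
    fun p hp h1 h2 => not_squarefree_of_sq_dvd (mem_oddPrimesBelow.1 hp).2.2 (dvd_add h1 h2)
  rcases mem_sumsetAvoidingSquarefree_cases ha with ⟨ha4, p, hp, hpa⟩ | ha <;>
    rcases mem_sumsetAvoidingSquarefree_cases hb with ⟨hb4, q, hq, hqb⟩ | hb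
  · exact not_squarefree_of_sq_dvd Nat.prime_two (by omega)
  · exact key p hp hpa ((sq_dvd_oddPrimorialSq hp).trans hb)
  · exact key q hq ((sq_dvd_oddPrimorialSq hq).trans ha) hqb
  · have h3 : 3 ∈ oddPrimesBelow N := mem_oddPrimesBelow.2 ⟨by norm_num, by omega, by norm_num⟩
    exact key 3 h3 ((sq_dvd_oddPrimorialSq h3).trans ha) ((sq_dvd_oddPrimorialSq h3).trans hb)

lemma exists_add_eq_of_mod_four_eq_zero {N n : ℕ} (hN : 6 ≤ N) (hn : 1000 ≤ n) (h4 : n % 4 = 0) :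
    ∃ a ∈ sumsetAvoidingSquarefree N, ∃ b ∈ sumsetAvoidingSquarefree N, n = a + b := by
  have h3 : 3 ∈ oddPrimesBelow N := mem_oddPrimesBelow.2 ⟨by norm_num, by omega, by norm_num⟩
  have h5 : 5 ∈ oddPrimesBelow N := mem_oddPrimesBelow.2 ⟨by norm_num, by omega, by norm_num⟩
  refine ⟨50 + 100 * ((n + 4) % 9), Or.inl ⟨by omega, 5, h5, by omega⟩,
    n - (50 + 100 * ((n + 4) % 9)), Or.inl ⟨by omega, 3, h3, by omega⟩, by omega⟩

lemma exists_add_eq_of_sq_dvd {N n p : ℕ} (hp : p ∈ oddPrimesBelow N)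
    (hn : 4 * oddPrimorialSq N ≤ n) (hpn : p ^ 2 ∣ n) (h4 : n % 4 ≠ 0) :
    ∃ a ∈ sumsetAvoidingSquarefree N, ∃ b ∈ sumsetAvoidingSquarefree N, n = a + b := by
  have hP := oddPrimorialSq_mod_four N
  have hd := sq_dvd_oddPrimorialSq hp
  have : n % 4 = 3 ∨ n % 4 = 1 ∨ n % 4 = 2 := by omega
  rcases this with h | h | h
  · exact ⟨_, Or.inr (Or.inl rfl), n - oddPrimorialSq N,
      Or.inl ⟨by omega, p, hp, Nat.dvd_sub hpn hd⟩, by omega⟩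
  · exact ⟨_, Or.inr (Or.inr (Or.inl rfl)), n - 3 * oddPrimorialSq N,
      Or.inl ⟨by omega, p, hp, Nat.dvd_sub hpn (hd.mul_left 3)⟩, by omega⟩
  · exact ⟨_, Or.inr (Or.inr (Or.inr rfl)), n - 4 * oddPrimorialSq N,
      Or.inl ⟨by omega, p, hp, Nat.dvd_sub hpn (hd.mul_left 4)⟩, by omega⟩

lemma exists_add_add_eq {N n : ℕ} (hN : 6 ≤ N) (hn : 4 * oddPrimorialSq N + 1018 ≤ n) :
    ∃ a ∈ sumsetAvoidingSquarefree N, ∃ b ∈ sumsetAvoidingSquarefree N,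
      ∃ c ∈ sumsetAvoidingSquarefree N, n = a + b + c := by
  have hP := oddPrimorialSq_mod_four N
  have h3 : 3 ∈ oddPrimesBelow N := mem_oddPrimesBelow.2 ⟨by norm_num, by omega, by norm_num⟩
  have key : ∀ c ∈ sumsetAvoidingSquarefree N, c + 1000 ≤ n → (n - c) % 4 = 0 →
      ∃ a ∈ sumsetAvoidingSquarefree N, ∃ b ∈ sumsetAvoidingSquarefree N,
        ∃ c ∈ sumsetAvoidingSquarefree N, n = a + b + c := by
    intro c hc hcn h4
    obtain ⟨a, ha, b, hb, h⟩ := exists_add_eq_of_mod_four_eq_zero hN (by omega) h4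
    exact ⟨a, ha, b, hb, c, hc, by omega⟩
  have : n % 4 = 0 ∨ n % 4 = 1 ∨ n % 4 = 2 ∨ n % 4 = 3 := by omega
  rcases this with h | h | h | h
  · exact key _ (Or.inr (Or.inr (Or.inr rfl))) (by omega) (by omega)
  · exact key _ (Or.inr (Or.inl rfl)) (by omega) (by omega)
  · exact key 18 (Or.inl ⟨by norm_num, 3, h3, by norm_num⟩) (by omega) (by omega)
  · exact key _ (Or.inr (Or.inr (Or.inl rfl))) (by omega) (by omega)

open scoped Classical in
lemma card_filter_not_squarefree_not_add_le {N : ℕ} (hN : 6 ≤ N) (x : ℕ) :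
    (((Finset.range x).filter (fun n => ¬ Squarefree n ∧
      ¬ ∃ a ∈ sumsetAvoidingSquarefree N, ∃ b ∈ sumsetAvoidingSquarefree N, n = a + b)).card : ℝ) ≤
      (4 * oddPrimorialSq N + 1000 : ℕ) + x * (2 / N) := by
  obtain ⟨k, rfl⟩ : ∃ k, N = k + 1 := ⟨N - 1, by omega⟩
  have hsub : (Finset.range x).filter (fun n => ¬ Squarefree n ∧
      ¬ ∃ a ∈ sumsetAvoidingSquarefree (k + 1), ∃ b ∈ sumsetAvoidingSquarefree (k + 1),
        n = a + b) ⊆ Finset.range (4 * oddPrimorialSq (k + 1) + 1000) ∪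
      (Finset.range x).filter (fun n => 0 < n ∧ ∃ d, k < d ∧ d ^ 2 ∣ n) := by
    intro n hn
    simp only [Finset.mem_filter, Finset.mem_union, Finset.mem_range] at hn ⊢
    obtain ⟨hnx, hsf, hex⟩ := hn
    rw [or_iff_not_imp_left, not_lt]
    intro hlarge
    have h4 : n % 4 ≠ 0 := fun h =>
      hex (exists_add_eq_of_mod_four_eq_zero hN (by omega) h)
    rw [Nat.squarefree_iff_prime_squarefree] at hsf
    push Not at hsf
    obtain ⟨p, hp, hpn⟩ := hsf
    rw [← sq] at hpn
    refine ⟨hnx, by omega, p, ?_, hpn⟩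
    by_contra! hpk
    have hp2 : p ≠ 2 := by
      rintro rfl
      omega
    exact hex (exists_add_eq_of_sq_dvd (mem_oddPrimesBelow.2 ⟨hp2, by omega, hp⟩) (by omega) hpn h4)
  have h := (Finset.card_le_card hsub).trans (Finset.card_union_le _ _)
  rw [Finset.card_range] at h
  have h' := Nat.cast_le (α := ℝ).2 h
  rw [Nat.cast_add] at h'
  refine h'.trans (add_le_add le_rfl ?_)
  simpa using card_filter_exists_sq_dvd_le k x

open scoped Classical in
lemma exists_le_card_filter_mem (N : ℕ) :
    ∃ K : ℝ, ∀ x : ℕ,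
      x * (1 / 4 - (1 / 4) * ∏ p ∈ oddPrimesBelow N, (1 - 1 / (p : ℝ) ^ 2)) - K ≤
        ((Finset.range x).filter (fun n => n ∈ sumsetAvoidingSquarefree N)).card := by
  obtain ⟨K₀, h₀⟩ := exists_abs_card_filter_sq_dvd_sub_le ∅ (by simp)
  obtain ⟨K₁, h₁⟩ := exists_abs_card_filter_sq_dvd_sub_le (oddPrimesBelow N)
    fun p hp => ⟨(mem_oddPrimesBelow.1 hp).2.2, (mem_oddPrimesBelow.1 hp).1⟩
  refine ⟨K₀ + K₁, fun x => ?_⟩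
  have hsub : (Finset.range x).filter (fun n => n % 4 = 2 ∧ ∀ p ∈ (∅ : Finset ℕ), ¬ p ^ 2 ∣ n) ⊆
      (Finset.range x).filter (fun n => n ∈ sumsetAvoidingSquarefree N) ∪
      (Finset.range x).filter (fun n => n % 4 = 2 ∧ ∀ p ∈ oddPrimesBelow N, ¬ p ^ 2 ∣ n) := by
    intro n hn
    simp only [Finset.mem_filter, Finset.mem_union, Finset.mem_range] at hn ⊢
    by_cases h : ∃ p ∈ oddPrimesBelow N, p ^ 2 ∣ n
    · exact Or.inl ⟨hn.1, Or.inl ⟨hn.2.1, h⟩⟩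
    · push Not at h
      exact Or.inr ⟨hn.1, hn.2.1, h⟩
  have h := Nat.cast_le (α := ℝ).2 ((Finset.card_le_card hsub).trans (Finset.card_union_le _ _))
  rw [Nat.cast_add] at h
  have h0 := (abs_le.1 (h₀ x)).1
  have h1 := (abs_le.1 (h₁ x)).2
  rw [Finset.prod_empty] at h0
  linarith

lemma prod_oddPrimesBelow {N : ℕ} (hN : 6 ≤ N) :
    ∏ p ∈ oddPrimesBelow N, (1 - 1 / (p : ℝ) ^ 2) =
      4 / 3 * ∏ p ∈ N.primesBelow, (1 - 1 / (p : ℝ) ^ 2) := by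
  have h2 : 2 ∈ N.primesBelow := Nat.mem_primesBelow.2 ⟨by omega, Nat.prime_two⟩
  rw [oddPrimesBelow, ← Finset.mul_prod_erase _ _ h2]
  push_cast
  ring

open scoped Classical in
/-- For every ε > 0 there is A ⊆ ℕ of lower density > 1/4 − 2/π² − ε such that
A + A contains no squarefree integer, A + A + A contains all but finitely many
positive integers, and the non-squarefree integers outside A + A have upper
density at most ε. -/
theorem stmt_13 (ε : ℝ) (hε : 0 < ε) :
    ∃ A : Set ℕ,
      (1 / 4 - 2 / π ^ 2 - ε <
        liminf (fun x : ℕ =>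
          (((Finset.range x).filter (fun n => n ∈ A)).card : ℝ) / x) atTop) ∧
      (∀ a ∈ A, ∀ b ∈ A, ¬ Squarefree (a + b)) ∧
      {n : ℕ | 0 < n ∧ ¬ ∃ a ∈ A, ∃ b ∈ A, ∃ c ∈ A, n = a + b + c}.Finite ∧
      limsup
        (fun x : ℕ =>
          (((Finset.range x).filter
            (fun n => ¬ Squarefree n ∧ ¬ ∃ a ∈ A, ∃ b ∈ A, n = a + b)).card : ℝ) / x)
        atTop ≤ ε := by
  have hprod : ∀ᶠ N : ℕ in atTop,
      ∏ p ∈ N.primesBelow, (1 - 1 / (p : ℝ) ^ 2) < 6 / π ^ 2 + ε :=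
    tendsto_prod_primesBelow_one_sub_inv_sq.eventually_lt_const (by linarith)
  have htail : ∀ᶠ N : ℕ in atTop, 2 / (N : ℝ) < ε / 2 :=
    (tendsto_const_div_atTop_nhds_zero_nat 2).eventually_lt_const (by linarith)
  obtain ⟨N, ⟨hprodN, htailN⟩, hN⟩ := ((hprod.and htail).and (eventually_ge_atTop 6)).exists
  refine ⟨sumsetAvoidingSquarefree N, ?_, fun a ha b hb => not_squarefree_add hN ha hb, ?_, ?_⟩
  · obtain ⟨K, hK⟩ := exists_le_card_filter_mem N
    rw [prod_oddPrimesBelow hN] at hK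
    have hsmall : ∀ᶠ x : ℕ in atTop, K / (x : ℝ) < ε / 6 :=
      (tendsto_const_div_atTop_nhds_zero_nat K).eventually_lt_const (by linarith)
    have hev : ∀ᶠ x : ℕ in atTop, 1 / 4 - 2 / π ^ 2 - ε / 2 ≤
        (((Finset.range x).filter (fun n => n ∈ sumsetAvoidingSquarefree N)).card : ℝ) / x := by
      filter_upwards [hsmall, eventually_gt_atTop 0] with x hx hx0
      have hx0' : (0 : ℝ) < x := by exact_mod_cast hx0
      have h := div_le_div_of_nonneg_right (hK x) hx0'.le
      rw [sub_div, mul_div_cancel_left₀ _ hx0'.ne'] at h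
      have hpi : (6 : ℝ) / π ^ 2 = 3 * (2 / π ^ 2) := by ring
      rw [hpi] at hprodN
      linarith
    refine lt_of_lt_of_le (by linarith) (le_liminf_of_le ?_ hev)
    refine IsBoundedUnder.isCoboundedUnder_ge ⟨1, eventually_map.2 (Eventually.of_forall fun x => ?_)⟩
    refine div_le_one_of_le₀ ?_ (Nat.cast_nonneg x)
    exact_mod_cast (Finset.card_filter_le _ _).trans_eq (Finset.card_range x)
  · refine (Set.finite_lt_nat (4 * oddPrimorialSq N + 1018)).subset fun n hn => ?_
    by_contra! h
    exact hn.2 (exists_add_add_eq hN (not_lt.1 h))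
  · refine limsup_le_of_le ?_ ?_
    · exact IsBoundedUnder.isCoboundedUnder_le
        ⟨0, eventually_map.2 (Eventually.of_forall fun x => by positivity)⟩
    · filter_upwards [(tendsto_const_div_atTop_nhds_zero_nat
        ((4 * oddPrimorialSq N + 1000 : ℕ) : ℝ)).eventually_lt_const (half_pos hε),
        eventually_gt_atTop 0] with x hx hx0
      have hx0' : (0 : ℝ) < x := by exact_mod_cast hx0
      have h := div_le_div_of_nonneg_right (card_filter_not_squarefree_not_add_le hN x) hx0'.le
      rw [add_div, mul_div_cancel_left₀ _ hx0'.ne'] at h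
      linarith
end
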